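/- Let (X,d) be a compact metric space, f : X → X continuous with h_top(f) < +∞, and φ, ψ ∈ C(X,ℝ) with ψ > 0. Define P_{ψ,φ}(β) := P_ψ(βφ) for β ∈ ℝ. If P_{ψ,φ} is differentiable at β₀ and there exists at least one equilibrium state of P_ψ(β₀φ), then every equilibrium state μ of P_ψ(β₀φ) satisfies (∫φ dμ)/(∫ψ dμ) = P_{ψ,φ}'(β₀). -/

import Mathlib

open Filter Set Topology MeasureTheory ENNReal

variable {X : Type*}

/-- Birkhoff sum `S_n φ = ∑_{i<n} φ ∘ f^i`. -/
def birkhoff (f : X → X) (φ : X → ℝ) (n : ℕ) (x : X) : ℝ :=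
  ∑ i ∈ Finset.range n, φ (f^[i] x)

section Metric
variable [MetricSpace X]

/-- `F` is an `(n,ε)`-spanning set of `Z`: every `y ∈ Z` is within Bowen distance
`d_n ≤ ε` of some point of `F`. -/
def IsSpanningSetOf (f : X → X) (n : ℕ) (ε : ℝ) (Z : Set X) (F : Finset X) : Prop :=
  ∀ y ∈ Z, ∃ x ∈ F, ∀ i < n, dist (f^[i] x) (f^[i] y) ≤ ε

/-- `E` is an `(n,ε)`-separated set of `Z`: `E ⊆ Z` and distinct points of `E` are at
Bowen distance `d_n > ε`. -/
def IsSeparatedSetOf (f : X → X) (n : ℕ) (ε : ℝ) (Z : Set X) (E : Finset X) : Prop :=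
  (E : Set X) ⊆ Z ∧ ∀ x ∈ E, ∀ y ∈ E, x ≠ y → ∃ i < n, ε < dist (f^[i] x) (f^[i] y)

/-- `S_T = {n : ℕ | ∃ x, S_nψ(x) ≤ T < S_{n+1}ψ(x)}`. -/
def inducedST (f : X → X) (ψ : X → ℝ) (T : ℝ) : Set ℕ :=
  {n | ∃ x : X, birkhoff f ψ n x ≤ T ∧ T < birkhoff f ψ (n + 1) x}

/-- `X_n = {x | S_nψ(x) ≤ T < S_{n+1}ψ(x)}`. -/
def inducedXn (f : X → X) (ψ : X → ℝ) (T : ℝ) (n : ℕ) : Set X :=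
  {x | birkhoff f ψ n x ≤ T ∧ T < birkhoff f ψ (n + 1) x}

/-- `Q_{ψ,T}(f,φ,ε)`: infimum over families of `(n,ε)`-spanning sets of the `X_n`, `n ∈ S_T`,
of `∑_{n ∈ S_T} ∑_{x ∈ F_n} e^{S_nφ(x)}`. -/
noncomputable def inducedQ (f : X → X) (ψ φ : X → ℝ) (T ε : ℝ) : ℝ≥0∞ :=
  ⨅ (F : ℕ → Finset X) (_ : ∀ n ∈ inducedST f ψ T,
      IsSpanningSetOf f n ε (inducedXn f ψ T n) (F n)),
    ∑' n : inducedST f ψ T, ∑ x ∈ F n, ENNReal.ofReal (Real.exp (birkhoff f φ n x))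

/-- `P_{ψ,T}(f,φ,ε)`: supremum over families of `(n,ε)`-separated sets of the `X_n`, `n ∈ S_T`,
of `∑_{n ∈ S_T} ∑_{x ∈ E_n} e^{S_nφ(x)}`. -/
noncomputable def inducedPsep (f : X → X) (ψ φ : X → ℝ) (T ε : ℝ) : ℝ≥0∞ :=
  ⨆ (E : ℕ → Finset X) (_ : ∀ n ∈ inducedST f ψ T,
      IsSeparatedSetOf f n ε (inducedXn f ψ T n) (E n)),
    ∑' n : inducedST f ψ T, ∑ x ∈ E n, ENNReal.ofReal (Real.exp (birkhoff f φ n x))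

/-- The ψ-induced topological pressure
`P_ψ(φ) = lim_{ε→0⁺} limsup_{T→∞} (1/T) log Q_{ψ,T}(f,φ,ε)`, the limit as `ε → 0⁺`
being realized as a `limsup` along `𝓝[>] 0` (since `ε ↦ limsup_T …` is monotone,
this coincides with the limit). -/
noncomputable def inducedPressure (f : X → X) (ψ φ : X → ℝ) : EReal :=
  limsup (fun ε : ℝ =>
    limsup (fun T : ℝ => ENNReal.log (inducedQ f ψ φ T ε) * ((T⁻¹ : ℝ) : EReal)) atTop)
    (𝓝[>] (0 : ℝ))

/-- Topological entropy `h_top(f) = P_ψ(0)` with `ψ ≡ 1`. -/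
noncomputable def topEntropy (f : X → X) : EReal :=
  inducedPressure f (fun _ => 1) (fun _ => 0)

end Metric
section Meas
variable [MetricSpace X] [MeasurableSpace X] [BorelSpace X]

/-- Entropy of the finite measurable partition of `X` induced by a map `q` into a finite
type: `H(q) = ∑_s -μ(q⁻¹{s}) log μ(q⁻¹{s})`. -/
noncomputable def mapEntropy {S : Type*} [Fintype S] (μ : Measure X) (q : X → S) : ℝ :=
  ∑ s : S, Real.negMulLog ((μ (q ⁻¹' {s})).toReal)

/-- Kolmogorov–Sinai (measure-theoretic) entropy `h_μ(f)`: the supremum, over finite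
measurable partitions (encoded as measurable maps `p : X → Fin k`), of
`lim_n (1/n) H(⋁_{i<n} f^{-i} p)`; the limit exists by subadditivity and is
realized here as a `liminf`. -/
noncomputable def measEntropy (f : X → X) (μ : Measure X) : EReal :=
  ⨆ (k : ℕ) (p : X → Fin k) (_ : Measurable p),
    liminf (fun n : ℕ =>
      (((n : ℝ)⁻¹ * mapEntropy μ (fun x (i : Fin n) => p (f^[i] x)) : ℝ) : EReal)) atTop

/-- The set `M(X,f)` of `f`-invariant Borel probability measures on `X`. -/
def invMeasures (f : X → X) : Set (Measure X) :=
  {μ | IsProbabilityMeasure μ ∧ ∀ B : Set X, MeasurableSet B → μ (f ⁻¹' B) = μ B}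

/-- `μ` is an equilibrium state of `P_ψ(φ)`:
`μ ∈ M(X,f)` and `P_ψ(φ) = (h_μ(f) + ∫φ dμ)/(∫ψ dμ)`. -/
noncomputable def equilibriumStates (f : X → X) (ψ φ : X → ℝ) : Set (Measure X) :=
  {μ | μ ∈ invMeasures f ∧
    inducedPressure f ψ φ =
      (measEntropy f μ + ((∫ x, φ x ∂μ : ℝ) : EReal)) / (((∫ x, ψ x ∂μ : ℝ) : EReal))}

end Meas

section Freeze
variable [MetricSpace X] [MeasurableSpace X] [BorelSpace X]

/-- `Max^ψ(φ) = sup_{μ ∈ M(X,f)} (∫φ dμ)/(∫ψ dμ)`. -/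
noncomputable def maxRatio (f : X → X) (ψ φ : X → ℝ) : ℝ :=
  ⨆ ν : invMeasures f, (∫ x, φ x ∂(ν : Measure X)) / (∫ x, ψ x ∂(ν : Measure X))

/-- `M_max^ψ(φ) = {μ ∈ M(X,f) : (∫φ dμ)/(∫ψ dμ) = Max^ψ(φ)}`. -/
def maxSet (f : X → X) (ψ φ : X → ℝ) : Set (Measure X) :=
  {μ ∈ invMeasures f |
    (∫ x, φ x ∂μ) / (∫ x, ψ x ∂μ) = maxRatio f ψ φ}

/-- `h_∞^ψ(φ) = sup{h_μ(f)/(∫ψ dμ) : μ ∈ M_max^ψ(φ)}`. -/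
noncomputable def hInfty (f : X → X) (ψ φ : X → ℝ) : EReal :=
  ⨆ μ : maxSet f ψ φ, measEntropy f (μ : Measure X) / (((∫ x, ψ x ∂(μ : Measure X) : ℝ)) : EReal)

end Freeze

/-! ### Birkhoff sums -/

lemma birkhoff_le {f : X → X} {φ : X → ℝ} {M : ℝ} (h : ∀ x, φ x ≤ M) (n : ℕ) (x : X) :
    birkhoff f φ n x ≤ n * M := by
  simpa [birkhoff] using Finset.sum_le_card_nsmul (Finset.range n) _ M fun i _ => h (f^[i] x)

lemma le_birkhoff {f : X → X} {φ : X → ℝ} {m : ℝ} (h : ∀ x, m ≤ φ x) (n : ℕ) (x : X) :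
    n * m ≤ birkhoff f φ n x := by
  simpa [birkhoff] using Finset.card_nsmul_le_sum (Finset.range n) _ m fun i _ => h (f^[i] x)

/-! ### Gibbs' inequality and finite partitions -/

/-- **Gibbs' inequality** against a strictly positive sub-probability vector. -/
lemma sum_negMulLog_le_sum_mul_neg_log {S : Type*} [Fintype S] {p w : S → ℝ}
    (hp : ∀ s, 0 ≤ p s) (hp1 : ∑ s, p s = 1) (hw : ∀ s, 0 < w s) (hw1 : ∑ s, w s ≤ 1) :
    ∑ s, Real.negMulLog (p s) ≤ ∑ s, p s * -Real.log (w s) := by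
  have key : ∀ s, Real.negMulLog (p s) ≤ p s * -Real.log (w s) + (w s - p s) := by
    intro s
    rcases (hp s).eq_or_lt with h | h
    · simp [← h, (hw s).le]
    · have h1 := Real.log_le_sub_one_of_pos (div_pos (hw s) h)
      rw [Real.log_div (hw s).ne' h.ne'] at h1
      have h2 := mul_le_mul_of_nonneg_left h1 h.le
      have h3 : p s * (w s / p s - 1) = w s - p s := by field_simp
      rw [h3] at h2
      rw [Real.negMulLog]
      linarith
  calc ∑ s, Real.negMulLog (p s) ≤ ∑ s, (p s * -Real.log (w s) + (w s - p s)) :=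
        Finset.sum_le_sum fun s _ => key s
    _ = ∑ s, p s * -Real.log (w s) + (∑ s, w s - ∑ s, p s) := by
        rw [Finset.sum_add_distrib, Finset.sum_sub_distrib]
    _ ≤ ∑ s, p s * -Real.log (w s) := by linarith

/-- Product weights with letter probability `e^{-κ}` for agreement: the loss of a disagreement
is a finite constant `l`. -/
lemma exists_letter_weights {k : ℕ} (hk : 0 < k) {κ : ℝ} (hκ : 0 < κ) :
    ∃ (v : Fin k → Fin k → ℝ) (l : ℝ), 0 ≤ l ∧ (∀ b b', 0 < v b b') ∧
      (∀ b', ∑ b, v b b' ≤ 1) ∧ (∀ b, -Real.log (v b b) ≤ κ) ∧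
      ∀ b b', -Real.log (v b b') ≤ κ + l := by
  have hk' : (0 : ℝ) < k := by exact_mod_cast hk
  have hk1 : (1 : ℝ) ≤ k := by exact_mod_cast hk
  have hδ : 0 < 1 - Real.exp (-κ) := by
    have : Real.exp (-κ) < 1 := Real.exp_lt_one_iff.2 (by linarith)
    linarith
  have hdk : 0 < (1 - Real.exp (-κ)) / k := div_pos hδ hk'
  have hl : 0 ≤ -Real.log ((1 - Real.exp (-κ)) / k) := by
    rw [neg_nonneg]
    refine Real.log_nonpos hdk.le ?_
    rw [div_le_one hk']
    linarith [Real.exp_pos (-κ)]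
  refine ⟨fun b b' => if b = b' then Real.exp (-κ) else (1 - Real.exp (-κ)) / k,
    -Real.log ((1 - Real.exp (-κ)) / k), hl, fun b b' => ?_, fun b' => ?_, fun b => ?_,
    fun b b' => ?_⟩
  · dsimp only
    split_ifs
    exacts [Real.exp_pos _, hdk]
  · calc ∑ b, (if b = b' then Real.exp (-κ) else (1 - Real.exp (-κ)) / k)
        ≤ ∑ b, ((if b = b' then Real.exp (-κ) else 0) + (1 - Real.exp (-κ)) / k) := by
          refine Finset.sum_le_sum fun b _ => ?_
          split_ifs <;> linarith
      _ = 1 := by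
          rw [Finset.sum_add_distrib, Finset.sum_ite_eq' Finset.univ b', Finset.sum_const,
            Finset.card_univ, Fintype.card_fin, nsmul_eq_mul, mul_div_cancel₀ _ hk'.ne']
          simp
  · simp
  · dsimp only
    split_ifs
    · rw [Real.log_exp]; linarith
    · linarith

lemma eventually_log_add_le {L : ℕ} (hL : 1 ≤ L) (b : ℝ) {κ : ℝ} (hκ : 0 < κ) :
    ∀ᶠ n : ℕ in atTop, Real.log (n * L + 2) + b ≤ κ * n := by
  have hL' : (1 : ℝ) ≤ L := by exact_mod_cast hL
  have hcast : Tendsto (fun n : ℕ => (n : ℝ)) atTop atTop := tendsto_natCast_atTop_atTop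
  have hlim : Tendsto (fun n : ℕ => (n : ℝ) * L + 2) atTop atTop :=
    tendsto_atTop_add_const_right _ _ (hcast.atTop_mul_const (by linarith))
  have hpos : (0 : ℝ) < κ / (2 * (L + 2)) := by positivity
  filter_upwards [hlim.eventually (Real.isLittleO_log_id_atTop.bound hpos),
    hcast.eventually_ge_atTop (2 * b / κ), eventually_ge_atTop 1] with n h1 h2 h3
  have h3' : (1 : ℝ) ≤ n := by exact_mod_cast h3
  have hx : (0 : ℝ) ≤ n * L + 2 := by positivity
  rw [id, Real.norm_eq_abs, Real.norm_of_nonneg hx] at h1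
  have h4 := (le_abs_self _).trans h1
  have h5 : κ / (2 * (L + 2)) * (n * L + 2) ≤ κ / 2 * n := by
    rw [div_mul_eq_mul_div, div_le_iff₀ (by positivity)]
    nlinarith [mul_nonneg hκ.le (sub_nonneg.2 h3')]
  rw [div_le_iff₀ hκ] at h2
  linarith

section Entropy

variable [MeasurableSpace X]

lemma mapEntropy_nonneg {S : Type*} [Fintype S] (μ : Measure X) [IsProbabilityMeasure μ]
    (q : X → S) : 0 ≤ mapEntropy μ q :=
  Finset.sum_nonneg fun _ _ => Real.negMulLog_nonneg ENNReal.toReal_nonneg measureReal_le_one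

/-- The entropy of a partition is at most the integral of any function dominating the
negative logarithm of a sub-probability vector on its atoms. -/
lemma mapEntropy_le_integral {S : Type*} [Fintype S] (μ : Measure X) [IsProbabilityMeasure μ]
    {q : X → S} (hq : ∀ s, MeasurableSet (q ⁻¹' {s})) {w : S → ℝ} (hw : ∀ s, 0 < w s)
    (hw1 : ∑ s, w s ≤ 1) {u : X → ℝ} (hu : Integrable u μ)
    (h : ∀ y, -Real.log (w (q y)) ≤ u y) :
    mapEntropy μ q ≤ ∫ y, u y ∂μ := by
  classical
  have hsplit : ∀ g : S → ℝ,
      (fun y => g (q y)) = fun y => ∑ s, (q ⁻¹' {s}).indicator (fun _ => g s) y := by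
    intro g
    funext y
    rw [Finset.sum_eq_single (q y)]
    · simp
    · intro b _ hb
      simp [Set.indicator, hb.symm]
    · simp
  have hint : ∀ (g : S → ℝ) (s : S), Integrable ((q ⁻¹' {s}).indicator (fun _ => g s)) μ :=
    fun g s => (integrable_const _).indicator (hq s)
  have hval : ∀ g : S → ℝ, ∫ y, g (q y) ∂μ = ∑ s, μ.real (q ⁻¹' {s}) * g s := by
    intro g
    rw [hsplit g, integral_finsetSum _ fun s _ => hint g s]
    exact Finset.sum_congr rfl fun s _ => by rw [integral_indicator_const _ (hq s), smul_eq_mul]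
  have hp1 : ∑ s, μ.real (q ⁻¹' {s}) = 1 := by
    have := hval fun _ => 1
    simpa using this.symm
  calc mapEntropy μ q ≤ ∑ s, μ.real (q ⁻¹' {s}) * -Real.log (w s) :=
        sum_negMulLog_le_sum_mul_neg_log (fun s => measureReal_nonneg) hp1 hw hw1
    _ = ∫ y, -Real.log (w (q y)) ∂μ := (hval fun s => -Real.log (w s)).symm
    _ ≤ ∫ y, u y ∂μ := by
        refine integral_mono ?_ hu h
        rw [hsplit fun s => -Real.log (w s)]
        exact integrable_finsetSum _ fun s _ => hint (fun s => -Real.log (w s)) s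

/-- An entropy bound obtained from a finite mixture of product weights: `I` indexes reference
words `c t`, `a t` is the mass of the word `c t`, and `v b b'` is the probability of reading
the letter `b` when the reference letter is `b'`. -/
lemma mapEntropy_le_integral_of_mixture {ι : Type*} {k n : ℕ} (μ : Measure X)
    [IsProbabilityMeasure μ] {q : X → Fin n → Fin k} (hq : ∀ s, MeasurableSet (q ⁻¹' {s}))
    (I : Finset ι) {a : ι → ℝ} (ha : ∀ t, 0 < a t) {A : ℝ} (hA : 0 < A)
    (haA : ∑ t ∈ I, a t ≤ A) (c : ι → Fin n → Fin k) {v : Fin k → Fin k → ℝ}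
    (hv : ∀ b b', 0 < v b b') (hv1 : ∀ b', ∑ b, v b b' ≤ 1) {u : X → ℝ} (hu : Integrable u μ)
    (h : ∀ y, ∃ t ∈ I, Real.log A - Real.log (a t) - ∑ i, Real.log (v (q y i) (c t i)) ≤ u y) :
    mapEntropy μ q ≤ ∫ y, u y ∂μ := by
  classical
  have : Nonempty X := μ.nonempty_of_neZero
  obtain ⟨t₀, ht₀, -⟩ := h (Classical.arbitrary X)
  have hpos : ∀ (s : Fin n → Fin k) t, 0 < a t * ∏ i, v (s i) (c t i) := fun s t =>
    mul_pos (ha t) (Finset.prod_pos fun i _ => hv _ _)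
  have hsum : ∀ s : Fin n → Fin k, 0 < ∑ t ∈ I, a t * ∏ i, v (s i) (c t i) := fun s =>
    Finset.sum_pos (fun t _ => hpos s t) ⟨t₀, ht₀⟩
  have hprod : ∀ t, ∑ s : Fin n → Fin k, ∏ i, v (s i) (c t i) ≤ 1 := by
    intro t
    rw [← Fintype.piFinset_univ, ← Finset.prod_univ_sum (fun _ => Finset.univ)
      (fun i b => v b (c t i))]
    exact Finset.prod_le_one (fun i _ => Finset.sum_nonneg fun b _ => (hv _ _).le)
      fun i _ => hv1 _
  refine mapEntropy_le_integral μ hq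
    (w := fun s => A⁻¹ * ∑ t ∈ I, a t * ∏ i, v (s i) (c t i))
    (fun s => mul_pos (inv_pos.2 hA) (hsum s)) ?_ hu fun y => ?_
  · rw [← Finset.mul_sum, Finset.sum_comm, inv_mul_le_iff₀ hA, mul_one]
    refine le_trans (Finset.sum_le_sum fun t _ => ?_) haA
    rw [← Finset.mul_sum]
    exact mul_le_of_le_one_right (ha t).le (hprod t)
  · obtain ⟨t, ht, hty⟩ := h y
    refine le_trans ?_ hty
    have h1 : a t * ∏ i, v (q y i) (c t i) ≤ ∑ t ∈ I, a t * ∏ i, v (q y i) (c t i) :=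
      Finset.single_le_sum (f := fun t => a t * ∏ i, v (q y i) (c t i))
        (fun t _ => (hpos _ t).le) ht
    have h2 := Real.log_le_log (hpos _ t) h1
    rw [Real.log_mul (ha t).ne' (Finset.prod_pos fun i _ => hv _ _).ne',
      Real.log_prod fun i _ => (hv _ _).ne'] at h2
    rw [Real.log_mul (inv_pos.2 hA).ne' (hsum _).ne', Real.log_inv]
    linarith

lemma measEntropy_nonneg [Nonempty X] (f : X → X) (μ : Measure X) [IsProbabilityMeasure μ] :
    0 ≤ measEntropy f μ := by
  refine le_trans (le_liminf_of_le (h := Eventually.of_forall fun n => ?_))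
    (le_iSup_of_le 1 (le_iSup_of_le (fun _ => 0) (le_iSup_of_le measurable_const le_rfl)))
  exact_mod_cast mul_nonneg (by positivity) (mapEntropy_nonneg μ _)

lemma integrable_birkhoff {f : X → X} {μ : Measure X} (hμ : MeasurePreserving f μ μ)
    {g : X → ℝ} (hg : Integrable g μ) (n : ℕ) : Integrable (birkhoff f g n) μ :=
  integrable_finsetSum _ fun i _ => (hμ.iterate i).integrable_comp_of_integrable hg

lemma integral_birkhoff {f : X → X} {μ : Measure X} (hμ : MeasurePreserving f μ μ)
    {g : X → ℝ} (hg : Integrable g μ) (n : ℕ) :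
    ∫ x, birkhoff f g n x ∂μ = n * ∫ x, g x ∂μ := by
  have hi : ∀ i, ∫ x, g (f^[i] x) ∂μ = ∫ x, g x ∂μ := by
    intro i
    have h := hμ.iterate i
    have hg' : AEStronglyMeasurable g (Measure.map f^[i] μ) := by
      rw [h.map_eq]
      exact hg.aestronglyMeasurable
    rw [← integral_map h.measurable.aemeasurable hg', h.map_eq]
  simp only [birkhoff]
  rw [integral_finsetSum (f := fun i x => g (f^[i] x)) _ fun i _ =>
      (hμ.iterate i).integrable_comp_of_integrable hg,
    Finset.sum_congr rfl fun i _ => hi i, Finset.sum_const, Finset.card_range, nsmul_eq_mul]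

end Entropy

section Metric

variable [MetricSpace X]

/-- A finite measurable partition of a compact metric space is, off a set of small measure,
constant at a uniform scale. -/
lemma exists_measurableSet_uniformly_constant [CompactSpace X] [MeasurableSpace X] [BorelSpace X]
    (μ : Measure X) [IsProbabilityMeasure μ] {k : ℕ} {p : X → Fin k} (hp : Measurable p)
    {η : ℝ} (hη : 0 < η) :
    ∃ K : Set X, MeasurableSet K ∧ μ.real Kᶜ ≤ η ∧
      ∃ ε > 0, ∀ x ∈ K, ∀ y ∈ K, dist x y < ε → p x = p y := by
  have hk : (0 : ℝ) < k + 1 := by positivity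
  have hpm : ∀ j, MeasurableSet (p ⁻¹' {j}) := fun j => hp (measurableSet_singleton j)
  choose B hBsub hBcl hBμ using fun j => (hpm j).exists_isClosed_sdiff_lt (μ := μ)
    (measure_ne_top _ _) (ε := ENNReal.ofReal (η / (k + 1)))
    (ENNReal.ofReal_pos.2 (div_pos hη hk)).ne'
  refine ⟨⋃ j, B j, MeasurableSet.iUnion fun j => (hBcl j).measurableSet, ?_, ?_⟩
  · have hsub : (⋃ j, B j)ᶜ ⊆ ⋃ j, (p ⁻¹' {j} \ B j) := by
      intro x hx
      exact mem_iUnion.2 ⟨p x, rfl, fun h => hx (mem_iUnion.2 ⟨_, h⟩)⟩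
    calc μ.real (⋃ j, B j)ᶜ ≤ μ.real (⋃ j, (p ⁻¹' {j} \ B j)) := measureReal_mono hsub
      _ ≤ ∑ j, μ.real (p ⁻¹' {j} \ B j) := measureReal_iUnion_fintype_le _
      _ ≤ ∑ _j : Fin k, η / (k + 1) := Finset.sum_le_sum fun j _ =>
          ENNReal.toReal_le_of_le_ofReal (div_pos hη hk).le (hBμ j).le
      _ ≤ η := by
          rw [Finset.sum_const, Finset.card_univ, Fintype.card_fin, nsmul_eq_mul,
            mul_div_assoc', div_le_iff₀ hk]
          nlinarith
  · have hev : ∀ i j, i ≠ j →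
        ∃ δ > 0, ∀ x ∈ B i, ∀ y ∈ B j, δ ≤ dist x y := by
      intro i j hij
      have hdis : Disjoint (B i) (B j) := by
        rw [Set.disjoint_left]
        intro x hx hy
        exact hij ((hBsub i hx).symm.trans (hBsub j hy))
      obtain ⟨δ, hδ, hd⟩ := hdis.exists_thickenings (hBcl i).isCompact (hBcl j)
      refine ⟨δ, hδ, fun x hx y hy => ?_⟩
      by_contra! hlt
      exact Set.disjoint_left.1 hd (Metric.mem_thickening_iff.2 ⟨x, hx, by rwa [dist_comm]⟩)
        (Metric.self_subset_thickening hδ _ hy)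
    choose! δ hδ hsep using hev
    have hev' : ∀ᶠ ε in 𝓝[>] (0 : ℝ), ∀ i j, i ≠ j → ε < δ i j := by
      rw [eventually_all]; intro i
      rw [eventually_all]; intro j
      rw [eventually_all]; intro hij
      exact nhdsWithin_le_nhds (Iio_mem_nhds (hδ i j hij))
    obtain ⟨ε, hε, hε0⟩ := (hev'.and self_mem_nhdsWithin).exists
    refine ⟨ε, hε0, fun x hx y hy hxy => ?_⟩
    obtain ⟨i, hi⟩ := mem_iUnion.1 hx
    obtain ⟨j, hj⟩ := mem_iUnion.1 hy
    by_contra hne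
    have hij : i ≠ j := by
      rintro rfl
      exact hne ((hBsub i hi).trans (hBsub i hj).symm)
    exact absurd (hsep i j hij x hi y hj) (not_le.2 (hxy.trans (hε i j hij)))

/-! ### Bounds on the induced pressure -/

/-- If the induced pressure is less than `s`, then at every small scale the partition functions
`Q_{ψ,T}` grow slower than `e^{sT}`. -/
lemma eventually_inducedQ_lt_exp {f : X → X} {ψ φ : X → ℝ} {s : ℝ}
    (h : inducedPressure f ψ φ < s) :
    ∀ᶠ ε in 𝓝[>] (0 : ℝ), ∀ᶠ T : ℝ in atTop,
      inducedQ f ψ φ T ε < ENNReal.ofReal (Real.exp (s * T)) := by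
  filter_upwards [eventually_lt_of_limsup_lt h] with ε hε
  filter_upwards [eventually_lt_of_limsup_lt hε, eventually_gt_atTop 0] with T hT hT0
  rw [← EReal.exp_coe, ← ENNReal.exp_log (inducedQ f ψ φ T ε), EReal.exp_lt_exp_iff]
  by_contra! hle
  refine absurd hT (not_lt.2 ?_)
  have h0 : (0 : EReal) ≤ ((T⁻¹ : ℝ) : EReal) := by exact_mod_cast (inv_pos.2 hT0).le
  have h1 := mul_le_mul_of_nonneg_right hle h0
  rwa [← EReal.coe_mul, mul_inv_cancel_right₀ hT0.ne'] at h1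

/-- A spanning family witnessing an upper bound on `Q_{ψ,T}`. -/
lemma exists_isSpanningSetOf_sum_le {f : X → X} {ψ φ : X → ℝ} {T ε r : ℝ} (hr : 0 ≤ r)
    (h : inducedQ f ψ φ T ε < ENNReal.ofReal r) :
    ∃ F : ℕ → Finset X, ∀ n ∈ inducedST f ψ T,
      IsSpanningSetOf f n ε (inducedXn f ψ T n) (F n) ∧
        ∑ x ∈ F n, Real.exp (birkhoff f φ n x) ≤ r := by
  simp only [inducedQ, iInf_lt_iff] at h
  obtain ⟨F, hF, hlt⟩ := h
  refine ⟨F, fun n hn => ⟨hF n hn, ?_⟩⟩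
  have h1 := (ENNReal.le_tsum (f := fun n : inducedST f ψ T =>
    ∑ x ∈ F n, ENNReal.ofReal (Real.exp (birkhoff f φ n x))) ⟨n, hn⟩).trans hlt.le
  rw [← ENNReal.ofReal_sum_of_nonneg fun x _ => (Real.exp_pos _).le] at h1
  exact (ENNReal.ofReal_le_ofReal_iff hr).1 h1

/-- The converse of `eventually_inducedQ_lt_exp`, with a non-strict inequality. -/
lemma inducedPressure_le_of_eventually {f : X → X} {ψ φ : X → ℝ} {s : ℝ}
    (h : ∀ᶠ ε in 𝓝[>] (0 : ℝ), ∀ᶠ T : ℝ in atTop,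
      inducedQ f ψ φ T ε ≤ ENNReal.ofReal (Real.exp (s * T))) :
    inducedPressure f ψ φ ≤ s := by
  refine limsup_le_of_le (h := ?_)
  filter_upwards [h] with ε hε
  refine limsup_le_of_le (h := ?_)
  filter_upwards [hε, eventually_gt_atTop 0] with T hT hT0
  rw [← EReal.exp_coe, ← ENNReal.exp_log (inducedQ f ψ φ T ε), EReal.exp_le_exp_iff] at hT
  have h0 : (0 : EReal) ≤ ((T⁻¹ : ℝ) : EReal) := by exact_mod_cast (inv_pos.2 hT0).le
  have h1 := mul_le_mul_of_nonneg_right hT h0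
  rwa [← EReal.coe_mul, mul_inv_cancel_right₀ hT0.ne'] at h1

/-- If the topological entropy is finite, then so is every induced pressure of a function
bounded above. -/
lemma inducedPressure_lt_top_of_topEntropy_lt_top [Nonempty X] {f : X → X} {ψ φ : X → ℝ}
    (htop : topEntropy f < ⊤) {m : ℝ} (hm : 0 < m) (hψ : ∀ x, m ≤ ψ x) {M : ℝ}
    (hφ : ∀ x, φ x ≤ M) : inducedPressure f ψ φ < ⊤ := by
  obtain ⟨C, hC, -⟩ := EReal.lt_iff_exists_real_btwn.1 htop
  refine lt_of_le_of_lt (inducedPressure_le_of_eventually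
    (s := (1 + C + |M|) / m) ?_) (EReal.coe_lt_top _)
  filter_upwards [eventually_inducedQ_lt_exp hC] with ε hε
  have hdiv : Tendsto (fun T : ℝ => T / m) atTop atTop := tendsto_id.atTop_div_const hm
  filter_upwards [hdiv.eventually hε, eventually_ge_atTop 0] with T hT hT0
  set N := ⌊T / m⌋₊
  have hTm : 0 ≤ T / m := div_nonneg hT0 hm.le
  have hNle : (N : ℝ) ≤ T / m := Nat.floor_le hTm
  have hlt : T / m < N + 1 := Nat.lt_floor_add_one _
  obtain ⟨F, hF⟩ := exists_isSpanningSetOf_sum_le (Real.exp_pos _).le hT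
  have hX : inducedXn f (fun _ => 1) (T / m) N = Set.univ := by
    ext x
    simp [inducedXn, birkhoff, hNle, hlt]
  obtain ⟨hspan, hcard⟩ := hF N (by
    obtain ⟨x⟩ := ‹Nonempty X›
    exact ⟨x, (hX.symm ▸ mem_univ x : x ∈ inducedXn f (fun _ => 1) (T / m) N)⟩)
  rw [hX] at hspan
  have hST : ∀ n ∈ inducedST f ψ T, n ≤ N := by
    rintro n ⟨x, hx, -⟩
    exact Nat.le_floor ((le_div_iff₀ hm).2 ((le_birkhoff hψ n x).trans hx))
  have hcard' : ((F N).card : ℝ) ≤ Real.exp (C * (T / m)) := by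
    simpa [birkhoff] using hcard
  refine (iInf₂_le (fun _ => F N) fun n hn y _ => ?_).trans ?_
  · obtain ⟨x, hx, hxy⟩ := hspan y (mem_univ y)
    exact ⟨x, hx, fun i hi => hxy i (hi.trans_le (hST n hn))⟩
  have hterm : ∀ n : inducedST f ψ T,
      ∑ x ∈ F N, ENNReal.ofReal (Real.exp (birkhoff f φ n x)) ≤
        ENNReal.ofReal (Real.exp (C * (T / m)) * Real.exp (N * |M|)) := by
    intro n
    rw [← ENNReal.ofReal_sum_of_nonneg fun x _ => (Real.exp_pos _).le]
    refine ENNReal.ofReal_le_ofReal ?_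
    calc ∑ x ∈ F N, Real.exp (birkhoff f φ n x) ≤ ∑ x ∈ F N, Real.exp (N * |M|) := by
          refine Finset.sum_le_sum fun x _ => Real.exp_le_exp.2 ?_
          refine (birkhoff_le (fun x => (hφ x).trans (le_abs_self M)) n x).trans ?_
          have : ((n : ℕ) : ℝ) ≤ N := by exact_mod_cast hST n n.2
          gcongr
      _ = (F N).card * Real.exp (N * |M|) := by rw [Finset.sum_const, nsmul_eq_mul]
      _ ≤ _ := by gcongr
  have hfin : inducedST f ψ T ⊆ (Finset.range (N + 1) : Set ℕ) := by
    intro n hn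
    simpa [Nat.lt_succ_iff] using hST n hn
  calc ∑' n : inducedST f ψ T, ∑ x ∈ F N, ENNReal.ofReal (Real.exp (birkhoff f φ n x))
      ≤ ∑' _ : inducedST f ψ T,
          ENNReal.ofReal (Real.exp (C * (T / m)) * Real.exp (N * |M|)) :=
        ENNReal.tsum_le_tsum hterm
    _ ≤ ∑' _ : (Finset.range (N + 1) : Set ℕ),
          ENNReal.ofReal (Real.exp (C * (T / m)) * Real.exp (N * |M|)) :=
        ENNReal.tsum_mono_subtype (fun _ => _) hfin
    _ = ENNReal.ofReal ((N + 1) * (Real.exp (C * (T / m)) * Real.exp (N * |M|))) := by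
        rw [Finset.tsum_subtype' (Finset.range (N + 1)) fun _ =>
            ENNReal.ofReal (Real.exp (C * (T / m)) * Real.exp (N * |M|)),
          Finset.sum_const, Finset.card_range, nsmul_eq_mul,
          ENNReal.ofReal_mul (p := (N : ℝ) + 1) (by positivity), ← Nat.cast_succ,
          ENNReal.ofReal_natCast]
    _ ≤ ENNReal.ofReal (Real.exp ((1 + C + |M|) / m * T)) := by
        refine ENNReal.ofReal_le_ofReal ?_
        calc ((N : ℝ) + 1) * (Real.exp (C * (T / m)) * Real.exp (N * |M|))
            ≤ Real.exp (T / m) * (Real.exp (C * (T / m)) * Real.exp (T / m * |M|)) := by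
              gcongr
              exact (Real.add_one_le_exp _).trans (Real.exp_le_exp.2 hNle)
          _ = Real.exp ((1 + C + |M|) / m * T) := by
              rw [← Real.exp_add, ← Real.exp_add]
              congr 1
              ring

/-! ### The variational inequality -/

section Measure

variable [MeasurableSpace X] [BorelSpace X]

lemma measurePreserving_of_mem_invMeasures {f : X → X} (hf : Continuous f) {μ : Measure X}
    (hμ : μ ∈ invMeasures f) : MeasurePreserving f μ μ :=
  ⟨hf.measurable, Measure.ext fun B hB => by rw [Measure.map_apply hf.measurable hB, hμ.2 B hB]⟩

/-- The entropy of a finite measurable partition is at most `s ∫ψ dμ - ∫φ dμ` for every `s`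
exceeding the induced pressure. -/
lemma liminf_mapEntropy_le [CompactSpace X] {f : X → X} (hf : Continuous f) {φ ψ : X → ℝ}
    (hφ : Continuous φ) (hψ : Continuous ψ) {m : ℝ} (hm : 0 < m) (hmψ : ∀ x, m ≤ ψ x)
    {μ : Measure X} (hμ : μ ∈ invMeasures f) {s : ℝ} (hs : inducedPressure f ψ φ < s)
    {k : ℕ} {p : X → Fin k} (hp : Measurable p) :
    liminf (fun n : ℕ =>
      (((n : ℝ)⁻¹ * mapEntropy μ (fun x (i : Fin n) => p (f^[i] x)) : ℝ) : EReal)) atTop ≤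
      ((s * ∫ x, ψ x ∂μ - ∫ x, φ x ∂μ : ℝ) : EReal) := by
  classical
  have hμ1 : IsProbabilityMeasure μ := hμ.1
  have hmp := measurePreserving_of_mem_invMeasures hf hμ
  obtain ⟨x₀⟩ : Nonempty X := μ.nonempty_of_neZero
  refine EReal.le_of_forall_lt_iff_le.1 fun z hz => ?_
  rw [EReal.coe_lt_coe_iff] at hz
  obtain ⟨κ, hκ⟩ : ∃ κ, κ = (z - (s * ∫ x, ψ x ∂μ - ∫ x, φ x ∂μ)) / 4 := ⟨_, rfl⟩
  have hκ0 : 0 < κ := by rw [hκ]; linarith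
  obtain ⟨v, l, hl, hv, hv1, hvd, hvl⟩ := exists_letter_weights (p x₀).pos hκ0
  obtain ⟨K, hK, hμK, ε₁, hε₁, hKp⟩ :=
    exists_measurableSet_uniformly_constant μ hp (div_pos hκ0 (by linarith : 0 < l + 1))
  obtain ⟨ε₂, hε₂, hunif⟩ := Metric.uniformContinuous_iff.1
    (CompactSpace.uniformContinuous_of_continuous hφ) κ hκ0
  have hsmall : ∀ᶠ ε in 𝓝[>] (0 : ℝ), ε < min (ε₁ / 2) ε₂ :=
    nhdsWithin_le_nhds (Iio_mem_nhds (lt_min (half_pos hε₁) hε₂))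
  obtain ⟨ε, hQ, hε⟩ := ((eventually_inducedQ_lt_exp hs).and hsmall).exists
  rw [lt_min_iff] at hε
  obtain ⟨T₀, hT₀⟩ := eventually_atTop.1 hQ
  have hfam : ∀ T, ∃ F : ℕ → Finset X, T₀ ≤ T → ∀ n ∈ inducedST f ψ T,
      IsSpanningSetOf f n ε (inducedXn f ψ T n) (F n) ∧
        ∑ x ∈ F n, Real.exp (birkhoff f φ n x) ≤ Real.exp (s * T) := by
    intro T
    by_cases hT : T₀ ≤ T
    · obtain ⟨F, hF⟩ := exists_isSpanningSetOf_sum_le (Real.exp_pos _).le (hT₀ T hT)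
      exact ⟨F, fun _ => hF⟩
    · exact ⟨fun _ => ∅, fun h => absurd h hT⟩
  choose F hF using hfam
  have hcode : ∀ x, ∃ b : Fin k, ∀ y ∈ K, dist x y ≤ ε → b = p y := by
    intro x
    by_cases h : ∃ y ∈ K, dist x y ≤ ε
    · obtain ⟨y, hy, hxy⟩ := h
      refine ⟨p y, fun y' hy' hxy' => hKp y hy y' hy' ?_⟩
      linarith [dist_triangle_left y y' x]
    · exact ⟨p x, fun y hy hxy => absurd ⟨y, hy, hxy⟩ h⟩
  choose c hc using hcode
  obtain ⟨L, hL1, hL⟩ : ∃ L : ℕ, 1 ≤ L ∧ ∀ x, ψ x ≤ L * m := by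
    obtain ⟨M, hM⟩ := isCompact_univ.bddAbove_image hψ.continuousOn
    obtain ⟨L, hL⟩ := exists_nat_ge (M / m)
    refine ⟨L + 1, Nat.le_add_left _ _, fun x => ?_⟩
    have h1 : ψ x ≤ M := hM ⟨x, mem_univ x, rfl⟩
    rw [div_le_iff₀ hm] at hL
    push_cast
    linarith
  have hint : ∀ {g : X → ℝ}, Continuous g → Integrable g μ := fun hg =>
    hg.integrable_of_hasCompactSupport (HasCompactSupport.of_compactSpace _)
  set g : X → ℝ := Kᶜ.indicator fun _ => l with hg
  have hgint : Integrable g μ := (integrable_const l).indicator hK.compl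
  have hgval : ∫ x, g x ∂μ ≤ κ := by
    rw [hg, integral_indicator_const _ hK.compl, smul_eq_mul]
    rw [le_div_iff₀ (by linarith)] at hμK
    nlinarith [measureReal_nonneg (μ := μ) (s := Kᶜ)]
  refine liminf_le_of_frequently_le' (Eventually.frequently ?_)
  filter_upwards [eventually_log_add_le hL1 (|s| * m) hκ0, eventually_gt_atTop 0,
    (tendsto_natCast_atTop_atTop (R := ℝ)).eventually_ge_atTop (T₀ / m)] with n hn hn0 hnT
  have hn0' : (0 : ℝ) < n := by exact_mod_cast hn0
  rw [div_le_iff₀ hm] at hnT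
  rw [EReal.coe_le_coe_iff, inv_mul_le_iff₀ hn0']
  set u : X → ℝ := fun y => (Real.log (n * L + 2) + |s| * m + 2 * (n * κ)) +
    (s * birkhoff f ψ n y - birkhoff f φ n y + birkhoff f g n y) with hu
  have hψn := integrable_birkhoff hmp (hint hψ) n
  have hφn := integrable_birkhoff hmp (hint hφ) n
  have hgn := integrable_birkhoff hmp hgint n
  have huint : Integrable u μ :=
    (integrable_const _).add (((hψn.const_mul s).sub hφn).add hgn)
  have huval : ∫ y, u y ∂μ = (Real.log (n * L + 2) + |s| * m + 2 * (n * κ)) +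
      n * (s * ∫ x, ψ x ∂μ - ∫ x, φ x ∂μ + ∫ x, g x ∂μ) := by
    have h1 : Integrable (fun y => s * birkhoff f ψ n y - birkhoff f φ n y) μ :=
      (hψn.const_mul s).sub hφn
    have h2 : Integrable (fun y => s * birkhoff f ψ n y - birkhoff f φ n y + birkhoff f g n y) μ :=
      h1.add hgn
    simp only [hu]
    rw [integral_add (integrable_const _) h2, integral_add h1 hgn,
      integral_sub (hψn.const_mul s) hφn, integral_const_mul,
      integral_birkhoff hmp (hint hψ), integral_birkhoff hmp (hint hφ),
      integral_birkhoff hmp hgint]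
    simp
    ring
  have hmeas : Measurable fun x (i : Fin n) => p (f^[i] x) :=
    measurable_pi_lambda _ fun i => hp.comp (hf.iterate i).measurable
  have hA : (0 : ℝ) < n * L + 2 := by positivity
  refine (mapEntropy_le_integral_of_mixture μ (fun σ => hmeas (measurableSet_singleton σ))
    (I := ((Finset.range (n * L + 2)).filter fun j : ℕ =>
      T₀ ≤ j * m ∧ n ∈ inducedST f ψ (j * m)).sigma fun j => F (j * m) n)
    (a := fun t : (_ : ℕ) × X => Real.exp (birkhoff f φ n t.2 - s * (t.1 * m)))
    (fun _ => Real.exp_pos _) hA ?_ (fun t i => c (f^[i] t.2)) hv hv1 huint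
    fun y => ?_).trans ?_
  · rw [Finset.sum_sigma]
    calc _ ≤ ∑ j ∈ (Finset.range (n * L + 2)).filter fun j : ℕ =>
          T₀ ≤ j * m ∧ n ∈ inducedST f ψ (j * m), (1 : ℝ) := by
          refine Finset.sum_le_sum fun j hj => ?_
          obtain ⟨-, hj1, hj2⟩ := Finset.mem_filter.1 hj
          simp only [Real.exp_sub]
          rw [← Finset.sum_div, div_le_one (Real.exp_pos _)]
          exact (hF _ hj1 n hj2).2
      _ ≤ ∑ j ∈ Finset.range (n * L + 2), (1 : ℝ) :=
          Finset.sum_le_sum_of_subset_of_nonneg (Finset.filter_subset _ _)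
            fun _ _ _ => zero_le_one
      _ = n * L + 2 := by simp
  · set B := birkhoff f ψ n y
    have hBn : n * m ≤ B := le_birkhoff hmψ n y
    have hBL : B ≤ n * (L * m) := birkhoff_le hL n y
    have hB0 : 0 ≤ B / m := div_nonneg ((by positivity : (0 : ℝ) ≤ n * m).trans hBn) hm.le
    set j := ⌈B / m⌉₊
    have hj1 : B ≤ j * m := (div_le_iff₀ hm).1 (Nat.le_ceil _)
    have hj2 : (j : ℝ) < B / m + 1 := Nat.ceil_lt_add_one hB0
    have hj3 : j * m < B + m := by
      have := mul_lt_mul_of_pos_right hj2 hm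
      rwa [add_mul, div_mul_cancel₀ _ hm.ne', one_mul] at this
    have hyX : y ∈ inducedXn f ψ (j * m) n := by
      refine ⟨hj1, hj3.trans_le ?_⟩
      rw [birkhoff, Finset.sum_range_succ]
      exact add_le_add_right (hmψ _) B
    have hjT : T₀ ≤ j * m := hnT.trans (hBn.trans hj1)
    have hjS : n ∈ inducedST f ψ (j * m) := ⟨y, hyX⟩
    have hjL : j < n * L + 2 := by
      have h1 : B / m ≤ n * L := by rw [div_le_iff₀ hm]; linarith
      have h2 : (j : ℝ) < (n * L + 2 : ℕ) := by push_cast; linarith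
      exact_mod_cast h2
    obtain ⟨x, hx, hxy⟩ := (hF _ hjT n hjS).1 y hyX
    refine ⟨⟨j, x⟩, Finset.mem_sigma.2 ⟨Finset.mem_filter.2
      ⟨Finset.mem_range.2 hjL, hjT, hjS⟩, hx⟩, ?_⟩
    have hφxy : birkhoff f φ n y ≤ birkhoff f φ n x + n * κ := by
      have : ∀ i ∈ Finset.range n, φ (f^[i] y) ≤ φ (f^[i] x) + κ := by
        intro i hi
        have h1 := hunif ((hxy i (Finset.mem_range.1 hi)).trans_lt hε.2)
        rw [Real.dist_eq] at h1
        linarith [(abs_lt.1 h1).1]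
      simpa [birkhoff, Finset.sum_add_distrib] using Finset.sum_le_sum this
    have hlog : -∑ i : Fin n, Real.log (v (p (f^[i] y)) (c (f^[i] x))) ≤
        n * κ + birkhoff f g n y := by
      have : ∀ i : Fin n, -Real.log (v (p (f^[i] y)) (c (f^[i] x))) ≤ κ + g (f^[i] y) := by
        intro i
        by_cases hiK : f^[i] y ∈ K
        · rw [hc _ _ hiK (hxy i i.2), hg, Set.indicator_of_notMem (not_not.2 hiK), add_zero]
          exact hvd _
        · rw [hg, Set.indicator_of_mem (show f^[i] y ∈ Kᶜ from hiK)]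
          exact hvl _ _
      rw [← Finset.sum_neg_distrib, birkhoff, Finset.sum_range]
      simpa [Finset.sum_add_distrib] using Finset.sum_le_sum (s := Finset.univ) fun i _ => this i
    have hsj : s * (j * m) ≤ s * B + |s| * m := by
      have h1 : s * (j * m - B) ≤ |s| * m := by
        have h2 : 0 ≤ j * m - B := by linarith
        calc s * (j * m - B) ≤ |s| * (j * m - B) :=
              mul_le_mul_of_nonneg_right (le_abs_self s) h2
          _ ≤ |s| * m := mul_le_mul_of_nonneg_left (by linarith) (abs_nonneg s)
      linarith
    simp only [hu, Real.log_exp]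
    linarith
  · rw [huval]
    have hz4 : z = s * ∫ x, ψ x ∂μ - ∫ x, φ x ∂μ + 4 * κ := by rw [hκ]; ring
    have := mul_le_mul_of_nonneg_left hgval hn0'.le
    rw [hz4]
    linarith

/-- The variational inequality for the induced pressure. -/
lemma measEntropy_add_le_of_inducedPressure_lt [CompactSpace X] {f : X → X} (hf : Continuous f)
    {φ ψ : X → ℝ} (hφ : Continuous φ) (hψ : Continuous ψ) {m : ℝ} (hm : 0 < m)
    (hmψ : ∀ x, m ≤ ψ x) {μ : Measure X} (hμ : μ ∈ invMeasures f) {s : ℝ}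
    (hs : inducedPressure f ψ φ < s) :
    measEntropy f μ ≤ ((s * ∫ x, ψ x ∂μ - ∫ x, φ x ∂μ : ℝ) : EReal) :=
  iSup_le fun _ => iSup_le fun _ => iSup_le fun hp =>
    liminf_mapEntropy_le hf hφ hψ hm hmψ hμ hs hp

end Measure

end Metric

/-- Set `P_{ψ,φ}(β) := P_ψ(βφ)`. If `P_{ψ,φ}` is differentiable at
`β₀` (with derivative `D`) and `P_ψ(β₀φ)` has an equilibrium state, then every
equilibrium state `μ` of `P_ψ(β₀φ)` satisfies `(∫φ dμ)/(∫ψ dμ) = P_{ψ,φ}'(β₀)`. -/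
theorem equilibrium_ratio_eq_deriv
    {X : Type*} [MetricSpace X] [CompactSpace X] [Nonempty X]
    [MeasurableSpace X] [BorelSpace X]
    (f : X → X) (hf : Continuous f)
    (φ ψ : X → ℝ) (hφ : Continuous φ) (hψ : Continuous ψ) (hψpos : ∀ x, 0 < ψ x)
    (htop : topEntropy f < ⊤)
    (β₀ D : ℝ)
    (hD : HasDerivAt (fun β : ℝ => (inducedPressure f ψ (fun x => β * φ x)).toReal) D β₀)
    (hex : (equilibriumStates f ψ (fun x => β₀ * φ x)).Nonempty) :
    ∀ μ ∈ equilibriumStates f ψ (fun x => β₀ * φ x),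
      (∫ x, φ x ∂μ) / (∫ x, ψ x ∂μ) = D := by
  intro μ hμ
  obtain ⟨hμinv, hμeq⟩ := hμ
  have hμ1 : IsProbabilityMeasure μ := hμinv.1
  obtain ⟨xm, -, hxm⟩ := isCompact_univ.exists_isMinOn univ_nonempty hψ.continuousOn
  have hmψ : ∀ x, ψ xm ≤ ψ x := fun x => hxm (mem_univ x)
  have hm : 0 < ψ xm := hψpos xm
  set I := ∫ x, ψ x ∂μ
  set J := ∫ x, φ x ∂μ
  have hint : ∀ {g : X → ℝ}, Continuous g → Integrable g μ := fun hg =>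
    hg.integrable_of_hasCompactSupport (HasCompactSupport.of_compactSpace _)
  have hI0 : 0 < I := by
    have := integral_mono (integrable_const (ψ xm)) (hint hψ) hmψ
    rw [integral_const, probReal_univ, one_smul] at this
    exact hm.trans_le this
  have hcont : ∀ β : ℝ, Continuous fun x => β * φ x := fun β => continuous_const.mul hφ
  have hlt : ∀ β : ℝ, inducedPressure f ψ (fun x => β * φ x) < ⊤ := by
    intro β
    obtain ⟨M, hM⟩ := isCompact_univ.bddAbove_image (hcont β).continuousOn
    exact inducedPressure_lt_top_of_topEntropy_lt_top htop hm hmψ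
      fun x => hM ⟨x, mem_univ x, rfl⟩
  have hvar : ∀ β s : ℝ, inducedPressure f ψ (fun x => β * φ x) < s →
      measEntropy f μ ≤ ((s * I - β * J : ℝ) : EReal) := by
    intro β s hs
    simpa only [integral_const_mul] using
      measEntropy_add_le_of_inducedPressure_lt hf (hcont β) hψ hm hmψ hμinv hs
  obtain ⟨h, hh⟩ : ∃ h : ℝ, measEntropy f μ = h := by
    obtain ⟨s, hs, -⟩ := EReal.lt_iff_exists_real_btwn.1 (hlt 0)
    refine ⟨(measEntropy f μ).toReal, (EReal.coe_toReal ?_ ?_).symm⟩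
    · exact ((hvar 0 s hs).trans_lt (EReal.coe_lt_top _)).ne
    · exact ((EReal.bot_lt_zero).trans_le (measEntropy_nonneg f μ)).ne'
  have hle : ∀ β : ℝ, (((h + β * J) / I : ℝ) : EReal) ≤
      inducedPressure f ψ (fun x => β * φ x) := by
    intro β
    refine EReal.le_of_forall_lt_iff_le.1 fun s hs => ?_
    have h1 := hvar β s hs
    rw [hh, EReal.coe_le_coe_iff] at h1
    rw [EReal.coe_le_coe_iff, div_le_iff₀ hI0]
    linarith
  have hle' : ∀ β : ℝ, (h + β * J) / I ≤
      (inducedPressure f ψ (fun x => β * φ x)).toReal := by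
    intro β
    have h1 := EReal.toReal_le_toReal (hle β) (EReal.coe_ne_bot _) (hlt β).ne
    rwa [EReal.toReal_coe] at h1
  have heq : (inducedPressure f ψ (fun x => β₀ * φ x)).toReal = (h + β₀ * J) / I := by
    rw [hμeq, hh, integral_const_mul, ← EReal.coe_add, ← EReal.coe_div, EReal.toReal_coe]
  have hmin : IsLocalMin (fun β : ℝ =>
      (inducedPressure f ψ (fun x => β * φ x)).toReal - (h + β * J) / I) β₀ := by
    refine Eventually.of_forall fun β => ?_
    simp only [heq, sub_self]
    exact sub_nonneg.2 (hle' β)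
  have hlin : HasDerivAt (fun β : ℝ => (h + β * J) / I) (J / I) β₀ := by
    simpa using (((hasDerivAt_id β₀).mul_const J).const_add h).div_const I
  linarith [hmin.hasDerivAt_eq_zero (hD.sub hlin)]
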